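/- For every integer k ≥ 3, every p ∈ ℝ and every r > 0, the Fourier coefficients satisfy the recurrence r·∂a_k/∂r (p,r) + k·a_k(p,r) − r·∂a_{k−2}/∂r (p,r) + (k−2)·a_{k−2}(p,r) − 2r·∂b_{k−1}/∂p (p,r) = 0. -/

import Mathlib

open MeasureTheory Real Filter Finset

/-- Circular mean of `f` over the circle of radius `r` centered at `(p, 0)` on the x-axis:
`Mf(p,r) = (1/(2π)) ∫_{-π}^{π} f(p - r sin φ, r cos φ) dφ`. -/
noncomputable def circMean (f : ℝ × ℝ → ℝ) (p r : ℝ) : ℝ :=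
  (1 / (2 * Real.pi)) * ∫ φ in (-Real.pi)..Real.pi, f (p - r * Real.sin φ, r * Real.cos φ)

/-- `k`-th cosine Fourier coefficient of the restriction of `f` to the circle of
radius `r` centered at `(p, 0)`. -/
noncomputable def fourierA (f : ℝ × ℝ → ℝ) (k : ℕ) (p r : ℝ) : ℝ :=
  (1 / Real.pi) * ∫ φ in (-Real.pi)..Real.pi,
    f (p - r * Real.sin φ, r * Real.cos φ) * Real.cos (k * φ)

/-- `k`-th sine Fourier coefficient of the restriction of `f` to the circle of
radius `r` centered at `(p, 0)`. -/
noncomputable def fourierB (f : ℝ × ℝ → ℝ) (k : ℕ) (p r : ℝ) : ℝ :=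
  (1 / Real.pi) * ∫ φ in (-Real.pi)..Real.pi,
    f (p - r * Real.sin φ, r * Real.cos φ) * Real.sin (k * φ)

/-- Differentiation under the integral sign on a compact interval, for an integrand whose
derivative in the parameter is jointly continuous. -/
theorem hasDerivAt_intervalIntegral_of_continuous {G G' : ℝ → ℝ → ℝ} {a b : ℝ} (x₀ : ℝ)
    (hG : ∀ x, Continuous (G x)) (hG' : Continuous (Function.uncurry G'))
    (hd : ∀ x t, HasDerivAt (fun y => G y t) (G' x t) x) :
    HasDerivAt (fun x => ∫ t in a..b, G x t) (∫ t in a..b, G' x₀ t) x₀ := by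
  obtain ⟨C, hC⟩ := ((isCompact_closedBall x₀ 1).prod
    (isCompact_uIcc (a := a) (b := b))).exists_bound_of_continuousOn hG'.continuousOn
  refine (intervalIntegral.hasDerivAt_integral_of_dominated_loc_of_deriv_le
    (bound := fun _ => C) (Metric.ball_mem_nhds x₀ one_pos) ?_ ?_ ?_ ?_ ?_ ?_).2
  · exact Eventually.of_forall fun x => (hG x).aestronglyMeasurable
  · exact (hG x₀).intervalIntegrable _ _
  · exact (hG'.comp (Continuous.prodMk_right x₀)).aestronglyMeasurable
  · exact Eventually.of_forall fun t ht x hx =>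
      hC (x, t) ⟨Metric.ball_subset_closedBall hx, Set.uIoc_subset_uIcc ht⟩
  · exact intervalIntegrable_const
  · exact Eventually.of_forall fun t _ x _ => hd x t

/-- The `r`-derivative of a cosine coefficient, as an integral of the radial derivative. -/
theorem deriv_fourierA_radius {f : ℝ × ℝ → ℝ} (hf : ContDiff ℝ 1 f) (k : ℕ) (p r : ℝ) :
    deriv (fun r' => fourierA f k p r') r = (1 / Real.pi) * ∫ φ in (-Real.pi)..Real.pi,
      fderiv ℝ f (p - r * Real.sin φ, r * Real.cos φ) (-Real.sin φ, Real.cos φ) *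
        Real.cos (k * φ) := by
  have hfd := hf.continuous_fderiv one_ne_zero
  have hfc := hf.continuous
  refine ((hasDerivAt_intervalIntegral_of_continuous
    (G := fun r φ => f (p - r * Real.sin φ, r * Real.cos φ) * Real.cos (k * φ))
    (G' := fun r φ => fderiv ℝ f (p - r * Real.sin φ, r * Real.cos φ)
      (-Real.sin φ, Real.cos φ) * Real.cos (k * φ)) r ?_ ?_ ?_).const_mul _).deriv
  · intro x
    fun_prop
  · simp only [Function.uncurry_def]
    fun_prop
  · intro x t
    have h : HasDerivAt (fun y : ℝ => (p - y * Real.sin t, y * Real.cos t))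
        (-Real.sin t, Real.cos t) x := by
      simpa using (((hasDerivAt_id x).mul_const (Real.sin t)).const_sub p).prodMk
        ((hasDerivAt_id x).mul_const (Real.cos t))
    exact (((hf.differentiable one_ne_zero _).hasFDerivAt.comp_hasDerivAt x h).mul_const _)

/-- The `p`-derivative of a sine coefficient, as an integral of the horizontal derivative. -/
theorem deriv_fourierB_center {f : ℝ × ℝ → ℝ} (hf : ContDiff ℝ 1 f) (k : ℕ) (p r : ℝ) :
    deriv (fun p' => fourierB f k p' r) p = (1 / Real.pi) * ∫ φ in (-Real.pi)..Real.pi,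
      fderiv ℝ f (p - r * Real.sin φ, r * Real.cos φ) (1, 0) * Real.sin (k * φ) := by
  have hfd := hf.continuous_fderiv one_ne_zero
  have hfc := hf.continuous
  refine ((hasDerivAt_intervalIntegral_of_continuous
    (G := fun p φ => f (p - r * Real.sin φ, r * Real.cos φ) * Real.sin (k * φ))
    (G' := fun p φ => fderiv ℝ f (p - r * Real.sin φ, r * Real.cos φ) (1, 0) *
      Real.sin (k * φ)) p ?_ ?_ ?_).const_mul _).deriv
  · intro x
    fun_prop
  · simp only [Function.uncurry_def]
    fun_prop
  · intro x t
    have h : HasDerivAt (fun y : ℝ => (y - r * Real.sin t, r * Real.cos t)) (1, 0) x :=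
      ((hasDerivAt_id x).sub_const _).prodMk (hasDerivAt_const x _)
    exact (((hf.differentiable one_ne_zero _).hasFDerivAt.comp_hasDerivAt x h).mul_const _)

/-- Integration by parts in the angle: `k a_k` is minus the sine coefficient of the angular
derivative. -/
theorem natCast_mul_fourierA {f : ℝ × ℝ → ℝ} (hf : ContDiff ℝ 1 f) (k : ℕ) (p r : ℝ) :
    (k : ℝ) * fourierA f k p r = (1 / Real.pi) * ∫ φ in (-Real.pi)..Real.pi,
      -(fderiv ℝ f (p - r * Real.sin φ, r * Real.cos φ)
        (-(r * Real.cos φ), -(r * Real.sin φ)) * Real.sin (k * φ)) := by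
  have hfd := hf.continuous_fderiv one_ne_zero
  have hfc := hf.continuous
  have hd : ∀ φ, HasDerivAt
      (fun φ => f (p - r * Real.sin φ, r * Real.cos φ) * Real.sin (k * φ))
      (fderiv ℝ f (p - r * Real.sin φ, r * Real.cos φ)
        (-(r * Real.cos φ), -(r * Real.sin φ)) * Real.sin (k * φ) +
        f (p - r * Real.sin φ, r * Real.cos φ) * (Real.cos (k * φ) * k)) φ := by
    intro φ
    have h : HasDerivAt (fun φ : ℝ => (p - r * Real.sin φ, r * Real.cos φ))
        (-(r * Real.cos φ), -(r * Real.sin φ)) φ := by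
      simpa using (((Real.hasDerivAt_sin φ).const_mul r).const_sub p).prodMk
        ((Real.hasDerivAt_cos φ).const_mul r)
    have hs : HasDerivAt (fun φ : ℝ => Real.sin (k * φ)) (Real.cos (k * φ) * k) φ := by
      simpa using ((hasDerivAt_id φ).const_mul (k : ℝ)).sin
    exact ((hf.differentiable one_ne_zero _).hasFDerivAt.comp_hasDerivAt φ h).mul hs
  have hparts := intervalIntegral.integral_eq_sub_of_hasDerivAt (a := -Real.pi) (b := Real.pi)
    (fun φ _ => hd φ) (Continuous.intervalIntegrable (by fun_prop) _ _)
  rw [intervalIntegral.integral_add (Continuous.intervalIntegrable (by fun_prop) _ _)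
    (Continuous.intervalIntegrable (by fun_prop) _ _)] at hparts
  simp only [mul_neg, Real.sin_neg, Real.sin_nat_mul_pi, neg_zero, mul_zero, sub_zero,
    ← mul_assoc, intervalIntegral.integral_mul_const] at hparts
  rw [fourierA, intervalIntegral.integral_neg]
  linear_combination (1 / Real.pi) * hparts

/-- The recurrence for cosine coefficients, `k ≥ 3`:
`r ∂a_k/∂r + k a_k - r ∂a_{k-2}/∂r + (k-2) a_{k-2} - 2r ∂b_{k-1}/∂p = 0`. -/
theorem a_k_recurrence (f : ℝ × ℝ → ℝ) (hf : ContDiff ℝ (⊤ : ℕ∞) f)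
    (hfc : HasCompactSupport f) (hfs : tsupport f ⊆ {q : ℝ × ℝ | 0 < q.2})
    (k : ℕ) (hk : 3 ≤ k) (p r : ℝ) (hr : 0 < r) :
    r * deriv (fun r' => fourierA f k p r') r + (k : ℝ) * fourierA f k p r
      - r * deriv (fun r' => fourierA f (k - 2) p r') r
      + ((k : ℝ) - 2) * fourierA f (k - 2) p r
      - 2 * r * deriv (fun p' => fourierB f (k - 1) p' r) p = 0 := by
  have hf1 : ContDiff ℝ 1 f := hf.of_le (by exact_mod_cast le_top)
  have hfd := hf1.continuous_fderiv one_ne_zero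
  obtain ⟨m, rfl⟩ : ∃ m, k = m + 2 := ⟨k - 2, by omega⟩
  have hm : (((m + 2 : ℕ) : ℝ) - 2) = m := by push_cast; ring
  rw [show m + 2 - 2 = m by omega, show m + 2 - 1 = m + 1 by omega, hm,
    natCast_mul_fourierA hf1, natCast_mul_fourierA hf1, deriv_fourierA_radius hf1,
    deriv_fourierA_radius hf1, deriv_fourierB_center hf1]
  simp only [mul_left_comm _ (1 / Real.pi), ← intervalIntegral.integral_const_mul]
  rw [← intervalIntegral.integral_add, ← intervalIntegral.integral_sub,
    ← intervalIntegral.integral_add, ← intervalIntegral.integral_sub]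
  rotate_left
  iterate 8 exact Continuous.intervalIntegrable (by fun_prop) _ _
  refine (intervalIntegral.integral_congr (g := fun _ => 0) fun φ _ => ?_).trans
    intervalIntegral.integral_zero
  beta_reduce
  have hL : ∀ u v : ℝ, fderiv ℝ f (p - r * Real.sin φ, r * Real.cos φ) (u, v) =
      u * fderiv ℝ f (p - r * Real.sin φ, r * Real.cos φ) (1, 0) +
      v * fderiv ℝ f (p - r * Real.sin φ, r * Real.cos φ) (0, 1) := by
    intro u v
    rw [← smul_eq_mul u, ← smul_eq_mul v, ← map_smul, ← map_smul, ← map_add]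
    simp
  rw [hL (-Real.sin φ), hL (-(r * Real.cos φ))]
  generalize fderiv ℝ f (p - r * Real.sin φ, r * Real.cos φ) (1, 0) = X
  generalize fderiv ℝ f (p - r * Real.sin φ, r * Real.cos φ) (0, 1) = Y
  rw [show ((m + 2 : ℕ) : ℝ) * φ = ((m + 1 : ℕ) : ℝ) * φ + φ by push_cast; ring,
    show (m : ℝ) * φ = ((m + 1 : ℕ) : ℝ) * φ - φ by push_cast; ring,
    Real.cos_add, Real.sin_add, Real.cos_sub, Real.sin_sub]
  linear_combination
    1 / Real.pi * 2 * r * X * Real.sin (((m + 1 : ℕ) : ℝ) * φ) * Real.sin_sq_add_cos_sq φ
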